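/- Let V be a finite set, k ≥ 1, and E a set of k-element subsets of V with maximum degree Δ. Let p ∈ [0,1], let S be a Bernoulli(p) random subset of V, and let P_G := Pr[some hyperedge e ∈ E satisfies e ⊆ S]. Then for every k-element subset h of V with h ∉ E, the probability that h ⊆ S and some hyperedge e ∈ E satisfies e ⊆ S is at most p^k·(k·Δ·p + P_G). -/

import Mathlib

open MeasureTheory

/-- The Bernoulli(r) measure on `Bool`: `true` with probability `r`,
`false` with probability `1 - r`. -/
noncomputable def bernoulliMeasure (r : ℝ) : Measure Bool :=
  r.toNNReal • Measure.dirac true + (1 - r).toNNReal • Measure.dirac false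

instance (r : ℝ) : IsFiniteMeasure (bernoulliMeasure r) := by
  unfold bernoulliMeasure; infer_instance

/-- The distribution of a Bernoulli(r) random subset of `V`, encoded as the
product measure on `V → Bool` (a vertex `v` belongs to the subset iff the
coordinate at `v` is `true`). -/
noncomputable def bernoulliProduct (V : Type*) [Fintype V] (r : ℝ) :
    Measure (V → Bool) :=
  Measure.pi fun _ => bernoulliMeasure r

/-- Maximum degree of the hypergraph with edge set `E`. -/
def maxDegree {V : Type*} [Fintype V] [DecidableEq V] (E : Finset (Finset V)) : ℕ :=
  Finset.univ.sup fun v => (E.filter fun e => v ∈ e).card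

lemma bernoulliMeasure_singleton_true (r : ℝ) :
    bernoulliMeasure r {true} = ENNReal.ofReal r := by
  simp [bernoulliMeasure, ENNReal.ofReal]

lemma isProbabilityMeasure_bernoulliMeasure {r : ℝ} (h0 : 0 ≤ r) (h1 : r ≤ 1) :
    IsProbabilityMeasure (bernoulliMeasure r) := by
  constructor
  have key : ENNReal.ofReal r + ENNReal.ofReal (1 - r) = 1 := by
    rw [← ENNReal.ofReal_add h0 (by linarith)]
    simp
  rw [← key]
  simp [bernoulliMeasure, ENNReal.ofReal, -Bool.univ_eq]

/-- The probability that the random subset contains `A` is `r ^ |A|`. -/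
lemma bernoulliProduct_contains {V : Type*} [Fintype V] [DecidableEq V] {r : ℝ}
    (h0 : 0 ≤ r) (h1 : r ≤ 1) (A : Finset V) :
    bernoulliProduct V r {f | ∀ v ∈ A, f v = true} = ENNReal.ofReal r ^ A.card := by
  have := isProbabilityMeasure_bernoulliMeasure h0 h1
  have hset : {f : V → Bool | ∀ v ∈ A, f v = true} =
      Set.univ.pi fun v => if v ∈ A then {true} else Set.univ := by
    ext f
    simp only [Set.mem_ofPred_eq, Set.mem_univ_pi]
    refine forall_congr' fun v => ?_
    by_cases hv : v ∈ A <;> simp [hv]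
  rw [hset, bernoulliProduct, Measure.pi_pi]
  simp_rw [apply_ite (bernoulliMeasure r), bernoulliMeasure_singleton_true, measure_univ]
  simp

/-- Containing `h` is independent of containing some edge disjoint from `h`. -/
lemma bernoulliProduct_contains_inter_disjoint {V : Type*} [Fintype V] [DecidableEq V] {r : ℝ}
    (h0 : 0 ≤ r) (h1 : r ≤ 1) (h : Finset V) (E : Finset (Finset V)) :
    bernoulliProduct V r ({f | ∀ v ∈ h, f v = true} ∩
        {f | ∃ e ∈ E, Disjoint e h ∧ ∀ v ∈ e, f v = true}) =
      bernoulliProduct V r {f | ∀ v ∈ h, f v = true} *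
        bernoulliProduct V r {f | ∃ e ∈ E, Disjoint e h ∧ ∀ v ∈ e, f v = true} := by
  have := isProbabilityMeasure_bernoulliMeasure h0 h1
  have hind : ProbabilityTheory.iIndepFun (fun (v : V) (f : V → Bool) => f v) (bernoulliProduct V r) :=
    ProbabilityTheory.iIndepFun_pi (X := fun _ : V => (id : Bool → Bool)) fun _ => aemeasurable_id
  have hpair := hind.indepFun_finset h hᶜ disjoint_compl_right fun v => measurable_pi_apply v
  have hA : {f : V → Bool | ∀ v ∈ h, f v = true} =
      (fun (f : V → Bool) (v : h) => f v) ⁻¹' {g | ∀ v, g v = true} := by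
    ext f
    simp
  have hB : {f : V → Bool | ∃ e ∈ E, Disjoint e h ∧ ∀ v ∈ e, f v = true} =
      (fun (f : V → Bool) (v : (hᶜ : Finset V)) => f v) ⁻¹'
        {g | ∃ e ∈ E, Disjoint e h ∧ ∀ v : (hᶜ : Finset V), (v : V) ∈ e → g v = true} := by
    ext f
    simp only [Set.mem_ofPred_eq, Set.mem_preimage, Subtype.forall]
    refine exists_congr fun e => and_congr_right fun _ => and_congr_right fun hd => ?_
    exact ⟨fun H v _ hv => H v hv, fun H v hv => H v (Finset.mem_compl.mpr (Finset.disjoint_left.mp hd hv)) hv⟩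
  rw [hA, hB]
  exact hpair.measure_inter_preimage_eq_mul _ _ (Set.toFinite _).measurableSet
    (Set.toFinite _).measurableSet

/-- At most `|h| * Δ` edges meet `h`. -/
lemma card_filter_not_disjoint_le {V : Type*} [Fintype V] [DecidableEq V]
    (E : Finset (Finset V)) (h : Finset V) :
    (E.filter fun e => ¬ Disjoint e h).card ≤ h.card * maxDegree E := by
  have hsub : (E.filter fun e => ¬ Disjoint e h) ⊆ h.biUnion fun v => E.filter fun e => v ∈ e := by
    intro e he
    obtain ⟨heE, hd⟩ := Finset.mem_filter.mp he
    obtain ⟨v, hve, hvh⟩ := Finset.not_disjoint_iff.mp hd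
    exact Finset.mem_biUnion.mpr ⟨v, hvh, Finset.mem_filter.mpr ⟨heE, hve⟩⟩
  exact (Finset.card_le_card hsub).trans <| Finset.card_biUnion_le_card_mul _ _ _ fun v _ =>
    Finset.le_sup (f := fun v => (E.filter fun e => v ∈ e).card) (Finset.mem_univ v)

/-- for a non-edge `h`, the probability that a Bernoulli(p) test
contains `h` and also detects some hyperedge is at most `p^k (kΔp + P_G)`. -/
theorem stmt16 {V : Type*} [Fintype V] [DecidableEq V] (k : ℕ) (hk : 1 ≤ k)
    (E : Finset (Finset V)) (hunif : ∀ e ∈ E, e.card = k)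
    (Δ : ℕ) (hΔ : Δ = maxDegree E)
    (p : ℝ) (hp0 : 0 ≤ p) (hp1 : p ≤ 1)
    (PG : ℝ)
    (hPG : PG = (bernoulliProduct V p {f | ∃ e ∈ E, ∀ v ∈ e, f v = true}).toReal)
    (h : Finset V) (hcard : h.card = k) (hnotE : h ∉ E) :
    bernoulliProduct V p
        {f | (∀ v ∈ h, f v = true) ∧ ∃ e ∈ E, ∀ v ∈ e, f v = true} ≤
      ENNReal.ofReal (p ^ k * ((k : ℝ) * Δ * p + PG)) := by
  have := isProbabilityMeasure_bernoulliMeasure hp0 hp1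
  have : IsProbabilityMeasure (bernoulliProduct V p) := by
    unfold bernoulliProduct; infer_instance
  set μ := bernoulliProduct V p
  set I := E.filter fun e => ¬ Disjoint e h
  set A : Set (V → Bool) := {f | ∀ v ∈ h, f v = true}
  set D : Set (V → Bool) := {f | ∃ e ∈ E, Disjoint e h ∧ ∀ v ∈ e, f v = true}
  have hcover : {f : V → Bool | (∀ v ∈ h, f v = true) ∧ ∃ e ∈ E, ∀ v ∈ e, f v = true} ⊆
      (⋃ e ∈ I, {f | ∀ v ∈ h ∪ e, f v = true}) ∪ (A ∩ D) := by
    rintro f ⟨hf, e, he, hfe⟩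
    by_cases hd : Disjoint e h
    · exact Or.inr ⟨hf, e, he, hd, hfe⟩
    · refine Or.inl (Set.mem_biUnion (Finset.mem_filter.mpr ⟨he, hd⟩) fun v hv => ?_)
      exact (Finset.mem_union.mp hv).elim (hf v) (hfe v)
  have hpair : ∀ e ∈ I, μ {f | ∀ v ∈ h ∪ e, f v = true} ≤ ENNReal.ofReal p ^ (k + 1) := by
    intro e he
    have heE := (Finset.mem_filter.mp he).1
    rw [bernoulliProduct_contains hp0 hp1]
    refine pow_le_pow_right_of_le_one' (ENNReal.ofReal_le_one.mpr hp1) ?_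
    have hss : h ⊂ h ∪ e := by
      refine Finset.ssubset_iff_subset_ne.mpr ⟨Finset.subset_union_left, fun heq => hnotE ?_⟩
      have hsub : e ⊆ h := Finset.union_eq_left.mp heq.symm
      rwa [← Finset.eq_of_subset_of_card_le hsub (by rw [hcard, hunif e heE])]
    have := Finset.card_lt_card hss
    omega
  have hmeet : μ (⋃ e ∈ I, {f | ∀ v ∈ h ∪ e, f v = true}) ≤
      ((k * Δ : ℕ) : ENNReal) * ENNReal.ofReal p ^ (k + 1) := by
    refine (measure_biUnion_finset_le I _).trans ((Finset.sum_le_card_nsmul _ _ _ hpair).trans ?_)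
    rw [nsmul_eq_mul]
    have hI : I.card ≤ k * Δ := by
      rw [hΔ, ← hcard]
      exact card_filter_not_disjoint_le E h
    gcongr
  have hD : μ D ≤ ENNReal.ofReal PG := by
    rw [hPG, ENNReal.ofReal_toReal (measure_ne_top _ _)]
    exact measure_mono fun f ⟨e, he, _, hf⟩ => ⟨e, he, hf⟩
  have hdisj : μ (A ∩ D) ≤ ENNReal.ofReal p ^ k * ENNReal.ofReal PG := by
    rw [bernoulliProduct_contains_inter_disjoint hp0 hp1, bernoulliProduct_contains hp0 hp1, hcard]
    gcongr
  have hPG0 : 0 ≤ PG := hPG ▸ ENNReal.toReal_nonneg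
  calc μ _ ≤ _ := measure_mono hcover
    _ ≤ _ := measure_union_le _ _
    _ ≤ _ := add_le_add hmeet hdisj
    _ = ENNReal.ofReal (p ^ k * ((k : ℝ) * Δ * p + PG)) := by
      rw [← ENNReal.ofReal_natCast, ← ENNReal.ofReal_pow hp0, ← ENNReal.ofReal_pow hp0,
        ← ENNReal.ofReal_mul (by positivity), ← ENNReal.ofReal_mul (by positivity),
        ← ENNReal.ofReal_add (by positivity) (by positivity)]
      congr 1
      push_cast
      ring
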